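/- arXiv:1805.06968 — 2 statements merged into one kernel-verified Lean document; each statement's English description precedes it below -/
import Mathlib

section
/- Let 0 ≤ β < 1, n ≥ 1, a > 0, μ ≥ 0, and z_μ = z(μ/n, β) the solution in (0,1] of z e^{-βz} = e^{-β-μ/n}. Then the Szász-Mirakyan-Jain operator with parameter a satisfies R(t ↦ e^{-μt}) = e^{na(z_μ - 1)}. -/
open Real

/-- The Szász-Mirakyan-Jain operator with parameter `a`. -/
noncomputable def SMJ (β : ℝ) (n : ℕ) (a : ℝ) (f : ℝ → ℝ) : ℝ :=
  n * a * ∑' k : ℕ,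
    (n * a + β * k) ^ ((k : ℝ) - 1) / (Nat.factorial k : ℝ) *
      Real.exp (-(n * a + β * k)) * f (k / n)

open Polynomial Topology

/-- The coefficients `x (x + βk)^(k-1) / k!` of the Abel-Jain expansion of the exponential. -/
noncomputable def jainCoeff (x β : ℝ) (k : ℕ) : ℝ :=
  x * (x + β * k) ^ k / (x + β * k) / (Nat.factorial k : ℝ)

lemma jainCoeff_nonneg {x β : ℝ} (hx : 0 < x) (hβ : 0 ≤ β) (k : ℕ) : 0 ≤ jainCoeff x β k := by
  unfold jainCoeff
  positivity

lemma jainCoeff_mul_pow_le {x β c : ℝ} (hx : 0 < x) (hβ : 0 ≤ β) (hc : 0 < c) (k : ℕ) :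
    jainCoeff x β k * (c * exp (-β * c)) ^ k ≤ exp (c * x) := by
  have hy : 0 < x + β * k := by positivity
  calc jainCoeff x β k * (c * exp (-β * c)) ^ k
      = x / (x + β * k) *
          ((c * (x + β * k)) ^ k / (Nat.factorial k : ℝ) * exp (-β * c) ^ k) := by
        unfold jainCoeff
        rw [mul_pow, mul_pow]
        field_simp
    _ ≤ 1 * (exp (c * (x + β * k)) * exp (-β * c) ^ k) := by
        gcongr
        · rw [div_le_one hy]
          have : 0 ≤ β * k := by positivity
          linarith
        · exact pow_div_factorial_le_exp _ (by positivity) k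
    _ = exp (c * x) := by
        rw [one_mul, ← exp_nat_mul, ← exp_add]
        congr 1
        ring

lemma summable_jainCoeff_mul_pow {x β c r : ℝ} (hx : 0 < x) (hβ : 0 ≤ β) (hc : 0 < c)
    (hr : 0 ≤ r) (hrc : r < c * exp (-β * c)) : Summable fun k ↦ jainCoeff x β k * r ^ k := by
  set ρ := c * exp (-β * c) with hρ
  have hρ0 : 0 < ρ := by positivity
  refine Summable.of_nonneg_of_le
    (fun k ↦ mul_nonneg (jainCoeff_nonneg hx hβ k) (by positivity)) (fun k ↦ ?_)
    ((summable_geometric_of_lt_one (by positivity) ((div_lt_one hρ0).2 hrc)).mul_left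
      (exp (c * x)))
  calc jainCoeff x β k * r ^ k = jainCoeff x β k * ρ ^ k * (r / ρ) ^ k := by
        rw [mul_assoc, ← mul_pow, mul_div_cancel₀ _ hρ0.ne']
    _ ≤ exp (c * x) * (r / ρ) ^ k := by
        gcongr
        exact jainCoeff_mul_pow_le hx hβ hc k

lemma analyticAt_tsum_jainCoeff {x β c w : ℝ} (hx : 0 < x) (hβ : 0 ≤ β) (hc : 0 < c)
    (hw : |w| < c * exp (-β * c)) :
    AnalyticAt ℝ (fun w ↦ ∑' k, jainCoeff x β k * w ^ k) w := by
  have hρ : 0 ≤ c * exp (-β * c) := by positivity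
  have hrad : ENNReal.ofReal (c * exp (-β * c)) ≤
      (FormalMultilinearSeries.ofScalars ℝ (jainCoeff x β)).radius := by
    refine FormalMultilinearSeries.le_radius_of_bound _ (exp (c * x)) fun k ↦ ?_
    rw [FormalMultilinearSeries.ofScalars_norm, norm_of_nonneg (jainCoeff_nonneg hx hβ k),
      coe_toNNReal _ hρ]
    exact jainCoeff_mul_pow_le hx hβ hc k
  have hlt : ‖w‖ₑ < (FormalMultilinearSeries.ofScalars ℝ (jainCoeff x β)).radius := by
    refine lt_of_lt_of_le ?_ hrad
    rw [enorm_eq_ofReal_abs]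
    exact (ENNReal.ofReal_lt_ofReal_iff_of_nonneg (abs_nonneg w)).2 hw
  have h := (FormalMultilinearSeries.ofScalars ℝ (jainCoeff x β)).hasFPowerSeriesOnBall
    (lt_of_le_of_lt zero_le hlt)
  have h' := h.analyticAt_of_mem (y := w) (by simpa [Metric.mem_eball] using hlt)
  convert h' using 2 with v
  simp [FormalMultilinearSeries.sum, mul_comm]

/-- An alternating binomial sum of a polynomial of degree less than `m` vanishes. -/
lemma sum_antidiagonal_jainCoeff {x β : ℝ} (hx : 0 < x) (hβ : 0 ≤ β) (z : ℝ) {m : ℕ}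
    (hm : m ≠ 0) :
    ∑ p ∈ Finset.HasAntidiagonal.antidiagonal m,
      jainCoeff x β p.1 * z ^ p.1 * ((-((x + β * p.1) * z)) ^ p.2 / (Nat.factorial p.2 : ℝ)) =
      0 := by
  let P : ℝ[X] := (C β * X + C x) ^ (m - 1)
  have hP : P.natDegree < m := by
    have h1 : P.natDegree ≤ (m - 1) * 1 :=
      natDegree_pow_le_of_le _ natDegree_linear_le
    omega
  have h0 := congrFun (P.fwdDiff_iter_eq_zero_of_degree_lt hP) 0
  rw [fwdDiff_iter_eq_sum_shift] at h0
  rw [Finset.Nat.sum_antidiagonal_eq_sum_range_succ_mk]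
  have h1 : ∀ k ∈ Finset.range (m + 1),
      jainCoeff x β k * z ^ k *
        ((-((x + β * k) * z)) ^ (m - k) / (Nat.factorial (m - k) : ℝ)) =
      (x * z ^ m / (Nat.factorial m : ℝ)) *
        (((-1 : ℤ) ^ (m - k) * m.choose k) • P.eval ((0 : ℝ) + k • (1 : ℝ))) := by
    intro k hk
    have hkm : k ≤ m := by simpa [Nat.lt_succ_iff] using hk
    have hy : x + β * k ≠ 0 := by positivity
    obtain ⟨j, rfl⟩ := Nat.exists_eq_add_of_le hkm
    have hch : ((k + j).choose k : ℝ) * (Nat.factorial k * Nat.factorial j) =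
        Nat.factorial (k + j) := by
      have := Nat.choose_mul_factorial_mul_factorial hkm
      rw [Nat.add_sub_cancel_left] at this
      rw [← mul_assoc]
      exact_mod_cast this
    have hPk : P.eval ((0 : ℝ) + k • (1 : ℝ)) = (x + β * k) ^ (k + j) / (x + β * k) := by
      rw [eq_div_iff hy]
      obtain ⟨i, hi⟩ := Nat.exists_eq_succ_of_ne_zero hm
      simp only [P, hi, eval_pow, eval_add, eval_mul, eval_C, eval_X, nsmul_eq_mul, zero_add,
        mul_one, Nat.succ_sub_one, pow_succ]
      ring
    rw [hPk, Nat.add_sub_cancel_left, zsmul_eq_mul, jainCoeff, ← hch, neg_pow, mul_pow]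
    have : ((k + j).choose k : ℝ) ≠ 0 := by
      exact_mod_cast (Nat.choose_pos hkm).ne'
    push_cast
    field_simp
    ring
  rw [Finset.sum_congr rfl h1, ← Finset.mul_sum, h0]
  simp

lemma tsum_jainCoeff_of_small {x β c z : ℝ} (hx : 0 < x) (hβ : 0 ≤ β) (hc : 0 < c)
    (hz : |z| * exp (β * |z|) < c * exp (-β * c)) :
    ∑' k, jainCoeff x β k * (z * exp (-β * z)) ^ k = exp (x * z) := by
  let g : ℕ × ℕ → ℝ := fun p ↦
    jainCoeff x β p.1 * z ^ p.1 * ((-((x + β * p.1) * z)) ^ p.2 / (Nat.factorial p.2 : ℝ))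
  have hexp (t : ℝ) : HasSum (fun j : ℕ ↦ t ^ j / (Nat.factorial j : ℝ)) (exp t) := by
    rw [exp_eq_exp_ℝ]
    exact NormedSpace.expSeries_div_hasSum_exp t
  have hg : Summable g := by
    refine Summable.of_norm ((summable_prod_of_nonneg fun p ↦ norm_nonneg _).2 ?_)
    have hnorm (k : ℕ) : HasSum (fun j ↦ ‖g (k, j)‖)
        (exp (x * |z|) * (jainCoeff x β k * (|z| * exp (β * |z|)) ^ k)) := by
      have hy : 0 < x + β * k := by positivity
      convert! (hexp ((x + β * k) * |z|)).mul_left (jainCoeff x β k * |z| ^ k) using 1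
      · ext j
        simp [g, abs_of_nonneg (jainCoeff_nonneg hx hβ k), abs_of_pos hy]
      · rw [mul_pow, ← exp_nat_mul, mul_left_comm, mul_left_comm (exp _), ← exp_add, ← mul_assoc]
        congr 2
        ring
    refine ⟨fun k ↦ (hnorm k).summable, ?_⟩
    simp_rw [fun k ↦ (hnorm k).tsum_eq]
    exact (summable_jainCoeff_mul_pow hx hβ hc (by positivity) hz).mul_left _
  have hrows (k : ℕ) : HasSum (fun j ↦ g (k, j))
      (exp (-(x * z)) * (jainCoeff x β k * (z * exp (-β * z)) ^ k)) := by
    convert! (hexp (-((x + β * k) * z))).mul_left (jainCoeff x β k * z ^ k) using 1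
    rw [mul_pow, ← exp_nat_mul, mul_left_comm, mul_left_comm (exp _), ← exp_add, ← mul_assoc]
    congr 2
    ring
  have hdiag : ∑' p, g p = 1 := by
    rw [← Finset.HasAntidiagonal.sigmaAntidiagonalEquivProd.tsum_eq g]
    refine (((Finset.HasAntidiagonal.sigmaAntidiagonalEquivProd.summable_iff).2 hg).tsum_sigma'
        fun _ ↦ (hasSum_fintype _).summable).trans ?_
    rw [tsum_eq_single 0]
    · simp [g, jainCoeff, hx.ne']
    · intro m hm
      rw [tsum_fintype]
      exact (Finset.sum_coe_sort (Finset.HasAntidiagonal.antidiagonal m) g).trans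
        (sum_antidiagonal_jainCoeff hx hβ z hm)
  rw [hg.tsum_prod' fun k ↦ (hrows k).summable] at hdiag
  simp_rw [fun k ↦ (hrows k).tsum_eq] at hdiag
  rw [tsum_mul_left, exp_neg, inv_mul_eq_one₀ (exp_pos _).ne'] at hdiag
  exact hdiag.symm

lemma mul_exp_neg_lt {β c z : ℝ} (hc : 0 < c) (hβc : β * c < 1) (hzc : z < c) :
    z * exp (-β * z) < c * exp (-β * c) := by
  have h1 : 1 - β * (c - z) ≤ exp (-(β * (c - z))) := one_sub_le_exp_neg _
  have h2 : z < c * exp (-(β * (c - z))) := by nlinarith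
  calc z * exp (-β * z) < c * exp (-(β * (c - z))) * exp (-β * z) := by gcongr
    _ = c * exp (-β * c) := by
      rw [mul_assoc, ← exp_add]
      congr 2
      ring

/-- Jain's expansion of the exponential: with `w = z e^{-βz}`, the sum of
`x (x + βk)^(k-1) / k! * w^k` is `e^{xz}`. -/
lemma tsum_jainCoeff {x β z : ℝ} (hx : 0 < x) (hβ : 0 ≤ β) (hβ1 : β < 1) (hz0 : 0 ≤ z)
    (hz1 : z ≤ 1) :
    ∑' k, jainCoeff x β k * (z * exp (-β * z)) ^ k = exp (x * z) := by
  obtain ⟨c, hc1, hβc⟩ : ∃ c : ℝ, 1 < c ∧ β * c < 1 := by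
    refine ⟨2 / (1 + β), by rw [lt_div_iff₀ (by positivity)]; linarith, ?_⟩
    rw [← mul_div_assoc, div_lt_one (by positivity)]
    linarith
  have hc : 0 < c := by linarith
  have hf : AnalyticOnNhd ℝ
      (fun z ↦ ∑' k, jainCoeff x β k * (z * exp (-β * z)) ^ k) (Set.Icc 0 1) := by
    intro y hy
    have hw : AnalyticAt ℝ (fun y : ℝ ↦ y * exp (-β * y)) y := by fun_prop
    refine AnalyticAt.fun_comp (analyticAt_tsum_jainCoeff hx hβ hc ?_) hw
    rw [abs_of_nonneg (mul_nonneg hy.1 (exp_pos _).le)]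
    exact mul_exp_neg_lt hc hβc (hy.2.trans_lt hc1)
  have hg : AnalyticOnNhd ℝ (fun z ↦ exp (x * z)) (Set.Icc 0 1) := fun y _ ↦ by fun_prop
  have hfg : (fun z ↦ ∑' k, jainCoeff x β k * (z * exp (-β * z)) ^ k) =ᶠ[𝓝 0]
      fun z ↦ exp (x * z) := by
    have hcont : Continuous fun z : ℝ ↦ |z| * exp (β * |z|) := by fun_prop
    have : ∀ᶠ z : ℝ in 𝓝 0, |z| * exp (β * |z|) < c * exp (-β * c) :=
      hcont.continuousAt.eventually_lt continuousAt_const (by simpa using by positivity)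
    filter_upwards [this] with y hy using tsum_jainCoeff_of_small hx hβ hc hy
  exact hf.eqOn_of_preconnected_of_eventuallyEq hg isPreconnected_Icc
    (Set.left_mem_Icc.2 zero_le_one) hfg ⟨hz0, hz1⟩

/-- Exponential moment: if `z_μ ∈ (0,1]` solves `z e^{-βz} = e^{-β-μ/n}`, then
`R(t ↦ e^{-μt}) = e^{na(z_μ - 1)}`. -/
theorem SMJ_exp_moment (β a μ zμ : ℝ) (n : ℕ) (hβ0 : 0 ≤ β) (hβ1 : β < 1)
    (hn : 1 ≤ n) (ha : 0 < a) (hμ : 0 ≤ μ)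
    (hz0 : 0 < zμ) (hz1 : zμ ≤ 1)
    (hz : zμ * Real.exp (-β * zμ) = Real.exp (-β - μ / n)) :
    SMJ β n a (fun t => Real.exp (-μ * t)) = Real.exp (n * a * (zμ - 1)) := by
  have hn0 : (0 : ℝ) < n := by exact_mod_cast hn
  have hx : 0 < n * a := by positivity
  have hterm (k : ℕ) : (n * a) * ((n * a + β * k) ^ ((k : ℝ) - 1) / (Nat.factorial k : ℝ) *
      exp (-(n * a + β * k)) * exp (-μ * (k / n))) =
      exp (-(n * a)) * (jainCoeff (n * a) β k * (zμ * exp (-β * zμ)) ^ k) := by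
    have hy : 0 < n * a + β * k := by positivity
    have hexp : exp (-(n * a + β * k)) * exp (-μ * (k / n)) =
        exp (-(n * a)) * exp (-β - μ / n) ^ k := by
      rw [← exp_nat_mul, ← exp_add, ← exp_add]
      congr 1
      ring
    rw [hz, mul_assoc (_ / _), hexp, rpow_sub_one hy.ne', rpow_natCast, jainCoeff]
    ring
  rw [SMJ, ← tsum_mul_left, tsum_congr hterm, tsum_mul_left,
    tsum_jainCoeff hx hβ0 hβ1 hz0.le hz1, ← exp_add]
  congr 1
  ring
end

section
/- Fix λ > 0, 0 < β < 1, x ≥ 0, and let R_n^{(β)} be the exponential-preserving Szász-Mirakyan-Jain operator with α_n(x) = -λx/(n(z(λ/n,β)-1)). Then lim_{n→∞} n·R_n^{(β)}(t ↦ (t - x); x) = λx/(2(1-β)²). -/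
open Real

open Filter

/-- The coefficients `x (x + βk)^(k-1) / k!`, with value `1` at `k = 0`. -/
noncomputable def abelCoeff (β x : ℝ) : ℕ → ℝ
  | 0 => 1
  | k + 1 => x * (x + β * (k + 1)) ^ k / ((k + 1).factorial : ℝ)

/-- The coefficients `(y + βk)^k / k!`. -/
noncomputable def powCoeff (β y : ℝ) (k : ℕ) : ℝ :=
  (y + β * k) ^ k / (k.factorial : ℝ)

lemma alternating_sum_choose_mul_linear_pow_eq_zero (β x : ℝ) (n : ℕ) :
    ∑ i ∈ Finset.range (n + 2),
      (-1 : ℝ) ^ (n + 1 - i) * ((n + 1).choose i : ℝ) * (x + β * i) ^ n = 0 := by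
  let P : Polynomial ℝ := (Polynomial.C x + Polynomial.C β * Polynomial.X) ^ n
  have hP : P.natDegree < n + 1 := by
    have h1 : (Polynomial.C x + Polynomial.C β * Polynomial.X).natDegree ≤ 1 := by compute_degree
    have h2 := Polynomial.natDegree_pow_le_of_le n h1
    simp only [P]
    omega
  have h := congr_fun (Polynomial.fwdDiff_iter_eq_zero_of_degree_lt hP) 0
  rw [fwdDiff_iter_eq_sum_shift] at h
  simpa [P] using h

lemma hasDerivAt_powCoeff_succ (β y : ℝ) (k : ℕ) :
    HasDerivAt (fun y => powCoeff β y (k + 1)) (powCoeff β (y + β) k) y := by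
  unfold powCoeff
  have h := ((((hasDerivAt_id y).add_const (β * ((k + 1 : ℕ) : ℝ))).pow (k + 1)).div_const
    (((k + 1).factorial : ℕ) : ℝ))
  refine h.congr_deriv ?_
  have : (k.factorial : ℝ) ≠ 0 := by positivity
  have : (k : ℝ) + 1 ≠ 0 := by positivity
  simp only [Nat.factorial_succ, id, Nat.add_sub_cancel]
  push_cast
  field_simp
  ring

lemma abelCoeff_mul_powCoeff (β x : ℝ) (n i j : ℕ) (h : i + j = n + 1) :
    abelCoeff β x i * powCoeff β (-x - β * (n + 1)) j =
      x / ((n + 1).factorial : ℝ) * ((-1 : ℝ) ^ j * ((n + 1).choose i : ℝ) * (x + β * i) ^ n) := by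
  have hj : -x - β * (n + 1) + β * j = -(x + β * i) := by
    have : (n : ℝ) + 1 = i + j := by exact_mod_cast h.symm
    rw [this]; ring
  have hc : ((n + 1).choose i : ℝ) = ((n + 1).factorial : ℝ) / (i.factorial * j.factorial) := by
    rw [← h, Nat.cast_add_choose]
  rw [powCoeff, hj, neg_pow, hc]
  have h1 : ((n + 1).factorial : ℝ) ≠ 0 := by positivity
  have h2 : (j.factorial : ℝ) ≠ 0 := by positivity
  have h3 : (i.factorial : ℝ) ≠ 0 := by positivity
  cases i with
  | zero =>
    obtain rfl : j = n + 1 := by omega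
    simp only [abelCoeff, Nat.cast_zero, mul_zero, add_zero, Nat.factorial_zero, Nat.cast_one]
    field_simp
    ring
  | succ i =>
    obtain rfl : n = i + j := by omega
    simp only [abelCoeff]
    push_cast
    field_simp
    ring

/-- Abel's binomial identity. -/
lemma sum_antidiagonal_abelCoeff_mul_powCoeff (β x : ℝ) (n : ℕ) (y : ℝ) :
    ∑ p ∈ Finset.HasAntidiagonal.antidiagonal n, abelCoeff β x p.1 * powCoeff β y p.2 = powCoeff β (x + y) n := by
  induction n generalizing y with
  | zero => simp [abelCoeff, powCoeff]
  | succ n ih =>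
    let D : ℝ → ℝ := fun y =>
      ∑ p ∈ Finset.HasAntidiagonal.antidiagonal (n + 1), abelCoeff β x p.1 * powCoeff β y p.2
        - powCoeff β (x + y) (n + 1)
    have hD : ∀ y, HasDerivAt D 0 y := by
      intro y
      have h1 : HasDerivAt (fun y => ∑ p ∈ Finset.HasAntidiagonal.antidiagonal n,
          abelCoeff β x p.1 * powCoeff β y (p.2 + 1))
          (∑ p ∈ Finset.HasAntidiagonal.antidiagonal n, abelCoeff β x p.1 * powCoeff β (y + β) p.2) y :=
        HasDerivAt.fun_sum fun p _ => (hasDerivAt_powCoeff_succ β y p.2).const_mul _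
      have h2 : HasDerivAt (fun y => powCoeff β (x + y) (n + 1)) (powCoeff β (x + y + β) n) y :=
        (hasDerivAt_powCoeff_succ β (x + y) n).comp_const_add x y
      have h3 := (h1.const_add (abelCoeff β x (n + 1))).sub h2
      rw [ih, ← add_assoc, sub_self] at h3
      refine h3.congr_of_eventuallyEq (Eventually.of_forall fun y => ?_)
      simp [D, Finset.Nat.sum_antidiagonal_succ', powCoeff]
    have hconst := is_const_of_deriv_eq_zero (fun y => (hD y).differentiableAt)
      (fun y => (hD y).deriv) y (-x - β * (n + 1))
    have hzero : D (-x - β * (n + 1)) = 0 := by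
      have h1 : powCoeff β (x + (-x - β * (n + 1))) (n + 1) = 0 := by
        rw [powCoeff]
        push_cast
        rw [show x + (-x - β * (n + 1)) + β * (n + 1) = 0 by ring]
        simp
      simp only [D, h1, sub_zero]
      rw [Finset.sum_congr rfl fun p hp =>
        abelCoeff_mul_powCoeff β x n p.1 p.2 (Finset.HasAntidiagonal.mem_antidiagonal.1 hp),
        ← Finset.mul_sum,
        Finset.Nat.sum_antidiagonal_eq_sum_range_succ
          (fun i j => (-1 : ℝ) ^ j * ((n + 1).choose i : ℝ) * (x + β * i) ^ n),
        alternating_sum_choose_mul_linear_pow_eq_zero, mul_zero]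
    rw [hzero] at hconst
    exact sub_eq_zero.1 hconst

lemma abs_powCoeff_le {β y : ℝ} (hβ : 0 < β) (hy : 0 ≤ y) (k : ℕ) :
    |powCoeff β y k| ≤ exp (y / β) * (β * exp 1) ^ k := by
  have h := pow_div_factorial_le_exp (x := y / β + k) (by positivity) k
  have h2 : powCoeff β y k = β ^ k * ((y / β + k) ^ k / (k.factorial : ℝ)) := by
    rw [powCoeff, ← mul_div_assoc, ← mul_pow, mul_add, mul_div_cancel₀ _ hβ.ne']
  rw [abs_of_nonneg (by unfold powCoeff; positivity), h2]
  calc β ^ k * ((y / β + k) ^ k / (k.factorial : ℝ)) ≤ β ^ k * exp (y / β + k) := by gcongr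
    _ = exp (y / β) * (β * exp 1) ^ k := by
      rw [exp_add, mul_pow, ← exp_nat_mul, mul_one]; ring

section PowerSeries

variable {b : ℕ → ℝ} {C ρ u : ℝ}

lemma summable_norm_mul_pow (hρ : 0 < ρ) (hb : ∀ k, |b k| ≤ C * ρ ^ k) (hu : |u| < ρ⁻¹) :
    Summable fun k => ‖b k * u ^ k‖ := by
  have h1 : ρ * |u| < 1 := by
    rw [← mul_inv_cancel₀ hρ.ne']; gcongr
  refine Summable.of_nonneg_of_le (fun _ => norm_nonneg _) (fun k => ?_)
    ((summable_geometric_of_lt_one (by positivity) h1).mul_left C)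
  rw [norm_mul, norm_pow, norm_eq_abs, norm_eq_abs, mul_pow, ← mul_assoc]
  gcongr
  exact hb k

lemma summable_norm_mul_pow_succ_div (hρ : 0 < ρ) (hb : ∀ k, |b k| ≤ C * ρ ^ k)
    (hu : |u| < ρ⁻¹) : Summable fun k : ℕ => ‖b k * u ^ (k + 1) / (k + 1)‖ := by
  refine Summable.of_nonneg_of_le (fun _ => norm_nonneg _) (fun k => ?_)
    ((summable_norm_mul_pow hρ hb hu).mul_right |u|)
  rw [norm_div, pow_succ, ← mul_assoc, norm_mul _ u, norm_eq_abs u]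
  apply div_le_self (by positivity)
  rw [norm_eq_abs, abs_of_nonneg (by positivity)]
  linarith [(Nat.cast_nonneg k : (0 : ℝ) ≤ k)]

lemma hasDerivAt_tsum_mul_pow_succ_div (hρ : 0 < ρ) (hb : ∀ k, |b k| ≤ C * ρ ^ k)
    (hu : |u| < ρ⁻¹) :
    HasDerivAt (fun u => ∑' k : ℕ, b k * u ^ (k + 1) / (k + 1)) (∑' k, b k * u ^ k) u := by
  obtain ⟨r, hur, hr⟩ := exists_between hu
  have hr0 : 0 < r := (abs_nonneg u).trans_lt hur
  refine hasDerivAt_tsum_of_isPreconnected (u := fun k => ‖b k * r ^ k‖) (t := Metric.ball 0 r)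
    (y₀ := 0) (g := fun (k : ℕ) u => b k * u ^ (k + 1) / (k + 1)) (g' := fun k u => b k * u ^ k)
    (summable_norm_mul_pow hρ hb (by rwa [abs_of_pos hr0])) Metric.isOpen_ball
    (convex_ball 0 r).isPreconnected ?_ ?_ (by simpa) (by simp) (by simpa)
  · intro k y _
    refine (((hasDerivAt_pow (k + 1) y).const_mul (b k)).div_const ((k : ℝ) + 1)).congr_deriv ?_
    have : (k : ℝ) + 1 ≠ 0 := by positivity
    rw [div_eq_iff this, Nat.add_sub_cancel]
    push_cast
    ring
  · intro k y hy
    have : |y| ≤ r := by simpa using (mem_ball_zero_iff.1 hy).le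
    rw [norm_mul, norm_mul, norm_pow, norm_pow, norm_eq_abs y, norm_eq_abs r, abs_of_pos hr0]
    gcongr

end PowerSeries

/-- The power series with coefficients `powCoeff β y`. -/
noncomputable def powSeries (β y u : ℝ) : ℝ := ∑' k, powCoeff β y k * u ^ k

/-- The primitive of `powSeries β y` vanishing at `0`. -/
noncomputable def powPrimitive (β y u : ℝ) : ℝ :=
  ∑' k : ℕ, powCoeff β y k * u ^ (k + 1) / (k + 1)

/-- The power series with coefficients `abelCoeff β x`. -/
noncomputable def abelSeries (β x u : ℝ) : ℝ := ∑' k, abelCoeff β x k * u ^ k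

lemma abelCoeff_succ (β x : ℝ) (k : ℕ) :
    abelCoeff β x (k + 1) = x * (powCoeff β (x + β) k / (k + 1)) := by
  simp only [abelCoeff, powCoeff, Nat.factorial_succ]
  have : (k.factorial : ℝ) ≠ 0 := by positivity
  have : (k : ℝ) + 1 ≠ 0 := by positivity
  push_cast
  field_simp
  ring

lemma powCoeff_self_div (β : ℝ) (k : ℕ) : powCoeff β β k / (k + 1) = abelCoeff β β k := by
  cases k with
  | zero => simp [powCoeff, abelCoeff]
  | succ k =>
    simp only [abelCoeff, powCoeff]
    have : ((k + 1).factorial : ℝ) ≠ 0 := by positivity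
    have : (k : ℝ) + 1 + 1 ≠ 0 := by positivity
    push_cast
    field_simp
    ring

@[simp] lemma powPrimitive_zero (β y : ℝ) : powPrimitive β y 0 = 0 := by
  simp [powPrimitive]

section Convergence

variable {β x y u : ℝ}

lemma hasDerivAt_powPrimitive (hβ : 0 < β) (hy : 0 ≤ y) (hu : |u| < (β * exp 1)⁻¹) :
    HasDerivAt (powPrimitive β y) (powSeries β y u) u :=
  hasDerivAt_tsum_mul_pow_succ_div (by positivity) (abs_powCoeff_le hβ hy) hu

lemma summable_norm_abelCoeff_mul_pow (hβ : 0 < β) (hx : 0 ≤ x) (hu : |u| < (β * exp 1)⁻¹) :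
    Summable fun k => ‖abelCoeff β x k * u ^ k‖ := by
  rw [← summable_nat_add_iff 1]
  refine ((summable_norm_mul_pow_succ_div (by positivity)
    (abs_powCoeff_le hβ (add_nonneg hx hβ.le)) hu).mul_left ‖x‖).congr fun k => ?_
  rw [abelCoeff_succ, ← norm_mul]
  congr 1
  ring

lemma abelSeries_eq (hβ : 0 < β) (hx : 0 ≤ x) (hu : |u| < (β * exp 1)⁻¹) :
    abelSeries β x u = 1 + x * powPrimitive β (x + β) u := by
  rw [abelSeries, (summable_norm_abelCoeff_mul_pow hβ hx hu).of_norm.tsum_eq_zero_add,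
    powPrimitive, ← tsum_mul_left]
  congr 1
  · simp [abelCoeff]
  · refine tsum_congr fun k => ?_
    rw [abelCoeff_succ]
    ring

lemma abelSeries_mul_powSeries (hβ : 0 < β) (hx : 0 ≤ x) (hu : |u| < (β * exp 1)⁻¹) :
    abelSeries β x u * powSeries β β u = powSeries β (x + β) u := by
  rw [abelSeries, powSeries, tsum_mul_tsum_eq_tsum_sum_antidiagonal_of_summable_norm
    (summable_norm_abelCoeff_mul_pow hβ hx hu)
    (summable_norm_mul_pow (by positivity) (abs_powCoeff_le hβ hβ.le) hu), powSeries]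
  refine tsum_congr fun n => ?_
  rw [← sum_antidiagonal_abelCoeff_mul_powCoeff, Finset.sum_mul]
  refine Finset.sum_congr rfl fun p hp => ?_
  rw [← Finset.HasAntidiagonal.mem_antidiagonal.1 hp, pow_add]
  ring

lemma abelSeries_eq_exp (hβ : 0 < β) (hx : 0 ≤ x) (hu : |u| < (β * exp 1)⁻¹) :
    abelSeries β x u = exp (x * powPrimitive β β u) := by
  let r := (β * exp 1)⁻¹
  let f : ℝ → ℝ := fun u => (1 + x * powPrimitive β (x + β) u) * exp (-(x * powPrimitive β β u))
  have hf : ∀ v ∈ Metric.ball (0 : ℝ) r, HasDerivAt f 0 v := by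
    intro v hv
    have hv : |v| < r := by simpa using hv
    have h1 := ((hasDerivAt_powPrimitive hβ (add_nonneg hx hβ.le) hv).const_mul x).const_add 1
    have h2 := ((hasDerivAt_powPrimitive hβ hβ.le hv).const_mul x).fun_neg.exp
    refine (h1.mul h2).congr_deriv ?_
    rw [← abelSeries_mul_powSeries hβ hx hv, abelSeries_eq hβ hx hv]
    ring
  have hr : 0 < r := by positivity
  have h := Metric.isOpen_ball.is_const_of_deriv_eq_zero (convex_ball (0 : ℝ) r).isPreconnected
    (fun v hv => (hf v hv).differentiableAt.differentiableWithinAt)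
    (fun v hv => (hf v hv).deriv) (x := u) (y := 0)
    (mem_ball_zero_iff.2 hu) (Metric.mem_ball_self hr)
  simp only [f, powPrimitive_zero, mul_zero, add_zero, exp_zero,
    ← abelSeries_eq hβ hx hu, exp_neg, inv_one, mul_one] at h
  rwa [mul_inv_eq_one₀ (exp_pos _).ne'] at h

lemma powPrimitive_self_eq (hβ : 0 < β) (hu : |u| < (β * exp 1)⁻¹) :
    powPrimitive β β u = u * exp (β * powPrimitive β β u) := by
  rw [← abelSeries_eq_exp hβ hβ.le hu, abelSeries, powPrimitive, ← tsum_mul_left]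
  refine tsum_congr fun k => ?_
  rw [← powCoeff_self_div]
  ring

end Convergence

section Poisson

variable {β a : ℝ}

lemma exp_neg_lt_inv_mul_exp_one (hβ0 : 0 < β) (hβ1 : β < 1) : exp (-β) < (β * exp 1)⁻¹ := by
  have h := add_one_lt_exp (sub_neg.2 hβ1).ne
  rw [mul_inv, ← exp_neg, ← div_eq_inv_mul, lt_div_iff₀ hβ0]
  calc exp (-β) * β < exp (-β) * exp (β - 1) := by gcongr; linarith
    _ = exp (-1) := by rw [← exp_add]; ring_nf

lemma powPrimitive_self_exp_neg (hβ0 : 0 < β) (hβ1 : β < 1) :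
    powPrimitive β β (exp (-β)) = 1 := by
  have hr := exp_neg_lt_inv_mul_exp_one hβ0 hβ1
  have habs : ∀ v ∈ Set.Icc 0 (exp (-β)), |v| < (β * exp 1)⁻¹ := fun v hv => by
    rw [abs_of_nonneg hv.1]
    exact hv.2.trans_lt hr
  have hmem : exp (-β) ∈ Set.Icc 0 (exp (-β)) := ⟨(exp_pos _).le, le_rfl⟩
  have hlt : powPrimitive β β (exp (-β)) < 1 / β := by
    by_contra! hge
    have hcont : ContinuousOn (powPrimitive β β) (Set.Icc 0 (exp (-β))) := fun v hv =>
      (hasDerivAt_powPrimitive hβ0 hβ0.le (habs v hv)).continuousAt.continuousWithinAt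
    obtain ⟨v, hv, hv1⟩ := intermediate_value_Icc (exp_pos _).le hcont
      (show 1 / β ∈ _ from ⟨by rw [powPrimitive_zero]; positivity, hge⟩)
    have h := powPrimitive_self_eq hβ0 (habs v hv)
    rw [hv1, mul_one_div_cancel hβ0.ne'] at h
    have hv2 := habs v hv
    rw [abs_of_nonneg hv.1, mul_inv, ← div_eq_mul_inv, lt_div_iff₀ (exp_pos 1), ← h,
      one_div] at hv2
    exact hv2.false
  have heq := powPrimitive_self_eq hβ0 (habs _ hmem)
  set Y := powPrimitive β β (exp (-β))
  rw [← exp_add] at heq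
  have hY : 0 < Y := heq ▸ exp_pos _
  have hlog : log Y = -β + β * Y := by rw [heq, log_exp, ← heq]
  rw [lt_div_iff₀ hβ0] at hlt
  rcases lt_trichotomy Y 1 with h | h | h
  · nlinarith [log_le_sub_one_of_pos hY]
  · exact h
  · have h1 := one_sub_inv_le_log_of_pos hY
    rw [hlog] at h1
    have h2 := mul_le_mul_of_nonneg_right h1 hY.le
    rw [sub_mul, inv_mul_cancel₀ hY.ne'] at h2
    nlinarith

lemma powSeries_self_exp_neg (hβ0 : 0 < β) (hβ1 : β < 1) :
    powSeries β β (exp (-β)) = exp β / (1 - β) := by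
  have hu : |exp (-β)| < (β * exp 1)⁻¹ := by
    rw [abs_of_pos (exp_pos _)]
    exact exp_neg_lt_inv_mul_exp_one hβ0 hβ1
  have h1 := hasDerivAt_powPrimitive hβ0 hβ0.le hu
  have h2 := (hasDerivAt_id (exp (-β))).mul (h1.const_mul β).exp
  have h3 : powPrimitive β β =ᶠ[nhds (exp (-β))]
      (id * fun u => exp (β * powPrimitive β β u)) := by
    filter_upwards [continuous_abs.continuousAt.eventually_lt_const hu] with v hv
    exact powPrimitive_self_eq hβ0 hv
  have h := h1.unique (h2.congr_of_eventuallyEq h3)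
  rw [powPrimitive_self_exp_neg hβ0 hβ1] at h
  simp only [id, mul_one, one_mul, ← mul_assoc, ← exp_add, neg_add_cancel, exp_zero] at h
  rw [eq_div_iff (sub_pos.2 hβ1).ne']
  linarith

/-- The weights of the generalized Poisson distribution. -/
noncomputable def genPoisson (β a : ℝ) (k : ℕ) : ℝ :=
  exp (-a) * (abelCoeff β a k * exp (-β) ^ k)

lemma hasSum_genPoisson (hβ0 : 0 < β) (hβ1 : β < 1) (ha : 0 ≤ a) :
    HasSum (genPoisson β a) 1 := by
  have hu : |exp (-β)| < (β * exp 1)⁻¹ := by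
    rw [abs_of_pos (exp_pos _)]
    exact exp_neg_lt_inv_mul_exp_one hβ0 hβ1
  have h := ((summable_norm_abelCoeff_mul_pow hβ0 ha hu).of_norm.hasSum).mul_left (exp (-a))
  rw [← abelSeries, abelSeries_eq_exp hβ0 ha hu, powPrimitive_self_exp_neg hβ0 hβ1, mul_one,
    ← exp_add, neg_add_cancel, exp_zero] at h
  exact h

lemma hasSum_mul_genPoisson (hβ0 : 0 < β) (hβ1 : β < 1) (ha : 0 ≤ a) :
    HasSum (fun k : ℕ => k * genPoisson β a k) (a / (1 - β)) := by
  have hu : |exp (-β)| < (β * exp 1)⁻¹ := by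
    rw [abs_of_pos (exp_pos _)]
    exact exp_neg_lt_inv_mul_exp_one hβ0 hβ1
  have h := ((summable_norm_mul_pow (by positivity) (abs_powCoeff_le hβ0 (add_nonneg ha hβ0.le))
    hu).of_norm.hasSum).mul_left (exp (-a) * a * exp (-β))
  rw [← powSeries, ← abelSeries_mul_powSeries hβ0 ha hu, abelSeries_eq_exp hβ0 ha hu,
    powPrimitive_self_exp_neg hβ0 hβ1, powSeries_self_exp_neg hβ0 hβ1] at h
  rw [← hasSum_nat_add_iff' 1]
  have hval : exp (-a) * a * exp (-β) * (exp (a * 1) * (exp β / (1 - β))) =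
      a / (1 - β) - ∑ k ∈ Finset.range 1, (k : ℝ) * genPoisson β a k := by
    have : 1 - β ≠ 0 := (sub_pos.2 hβ1).ne'
    simp only [Finset.sum_range_one, Nat.cast_zero, zero_mul, sub_zero, exp_neg, mul_one]
    field_simp
  rw [hval] at h
  refine (congr_arg (HasSum · _) (funext fun k => ?_)).mpr h
  have : (k : ℝ) + 1 ≠ 0 := by positivity
  rw [genPoisson, abelCoeff_succ]
  push_cast
  field_simp
  ring

lemma mul_rpow_eq_genPoisson (ha : 0 < a) (k : ℕ) :
    a * ((a + β * k) ^ ((k : ℝ) - 1) / (k.factorial : ℝ) * exp (-(a + β * k))) =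
      genPoisson β a k := by
  have hexp : exp (-(a + β * k)) = exp (-a) * exp (-β) ^ k := by
    rw [← exp_nat_mul, ← exp_add]; ring_nf
  rw [hexp, genPoisson]
  cases k with
  | zero => simp [abelCoeff, rpow_neg_one, ha.ne']
  | succ k =>
    simp only [abelCoeff]
    push_cast
    rw [add_sub_cancel_right, rpow_natCast]
    ring

end Poisson

lemma SMJ_sub_eq {β : ℝ} (hβ0 : 0 < β) (hβ1 : β < 1) {n : ℕ} {a : ℝ} (ha : 0 < n * a) (x : ℝ) :
    SMJ β n a (fun t => t - x) = n * a / (1 - β) / n - x := by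
  have h := ((hasSum_mul_genPoisson hβ0 hβ1 ha.le).div_const (n : ℝ)).sub
    ((hasSum_genPoisson hβ0 hβ1 ha.le).mul_right x)
  rw [one_mul] at h
  rw [SMJ, ← tsum_mul_left, ← h.tsum_eq]
  refine tsum_congr fun k => ?_
  rw [← mul_rpow_eq_genPoisson ha]
  ring

lemma tendsto_neg_log_one_sub_sub_div_sq :
    Tendsto (fun s : ℝ => (-log (1 - s) - s) / s ^ 2) (nhdsWithin 0 (Set.Ioi 0))
      (nhds (1 / 2)) := by
  have hlim : Tendsto (fun s : ℝ => s / (1 - s)) (nhdsWithin 0 (Set.Ioi 0)) (nhds 0) := by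
    have : ContinuousAt (fun s : ℝ => s / (1 - s)) 0 :=
      continuousAt_id.div (by fun_prop) (by norm_num)
    simpa using this.tendsto.mono_left nhdsWithin_le_nhds
  rw [tendsto_iff_norm_sub_tendsto_zero]
  refine squeeze_zero' (Eventually.of_forall fun _ => norm_nonneg _) ?_ hlim
  filter_upwards [Ioo_mem_nhdsGT (zero_lt_one (α := ℝ))] with s hs
  obtain ⟨hs0, hs1⟩ := hs
  have h := abs_log_sub_add_sum_range_le (x := s) (by rwa [abs_of_pos hs0]) 2
  have heq : (-log (1 - s) - s) / s ^ 2 - 1 / 2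
      = -(∑ i ∈ Finset.range 2, s ^ (i + 1) / ((i : ℝ) + 1) + log (1 - s)) / s ^ 2 := by
    simp only [Finset.sum_range_succ, Finset.sum_range_zero]
    field_simp
    push_cast
    ring
  rw [heq, norm_div, norm_neg, norm_eq_abs, norm_of_nonneg (by positivity : (0 : ℝ) ≤ s ^ 2),
    div_le_iff₀ (by positivity)]
  rw [abs_of_pos hs0] at h
  exact h.trans_eq (by ring)

lemma tendsto_inv_sub_inv {β : ℝ} (hβ1 : β < 1) :
    Tendsto (fun s : ℝ => 1 / (s * (1 - β)) - 1 / (-β * s - log (1 - s)))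
      (nhdsWithin 0 (Set.Ioi 0)) (nhds (1 / (2 * (1 - β) ^ 2))) := by
  have hβ : 0 < 1 - β := sub_pos.2 hβ1
  have hL := tendsto_neg_log_one_sub_sub_div_sq
  have hs : Tendsto (fun s : ℝ => s) (nhdsWithin 0 (Set.Ioi 0)) (nhds 0) :=
    tendsto_id.mono_left nhdsWithin_le_nhds
  have h := hL.div (((hs.mul hL).const_add (1 - β)).mul_const (1 - β)) (by simpa using hβ.ne')
  have hval : 1 / 2 / ((1 - β + 0 * (1 / 2)) * (1 - β)) = 1 / (2 * (1 - β) ^ 2) := by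
    field_simp
    ring
  rw [hval] at h
  refine h.congr' ?_
  filter_upwards [Ioo_mem_nhdsGT (zero_lt_one (α := ℝ))] with s hs
  obtain ⟨hs0, hs1⟩ := hs
  have hlog : log (1 - s) ≤ -s := by linarith [log_le_sub_one_of_pos (sub_pos.2 hs1)]
  have ht : 0 < -β * s - log (1 - s) := by nlinarith
  have ht' : (1 - β + s * ((-log (1 - s) - s) / s ^ 2)) = (-β * s - log (1 - s)) / s := by
    field_simp
    ring
  simp only [Pi.div_apply]
  rw [ht']
  obtain ⟨t, hl⟩ : ∃ t, log (1 - s) = -β * s - t := ⟨-β * s - log (1 - s), by ring⟩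
  rw [hl, sub_sub_cancel] at ht ⊢
  field_simp
  ring

lemma lambert_deficit {β t w : ℝ} (hβ0 : 0 < β) (hβ1 : β < 1) (ht : 0 < t)
    (hw : w * exp w = -β * exp (-β - t)) (hw1 : -1 ≤ w) :
    0 < 1 + w / β ∧ 1 + w / β ≤ t / (1 - β) ∧
      -β * (1 + w / β) - log (1 - (1 + w / β)) = t := by
  have hβ : 0 < 1 - β := sub_pos.2 hβ1
  obtain ⟨z, rfl⟩ : ∃ z, w = -(β * z) := ⟨-w / β, by field_simp⟩
  have hz : z * exp (-(β * z)) = exp (-β - t) := by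
    apply mul_left_cancel₀ hβ0.ne'
    linarith
  have hz0 : 0 < z := pos_of_mul_pos_left (hz ▸ exp_pos _) (exp_pos _).le
  have hlog : log z = β * z - β - t := by
    have := congr_arg log hz
    rw [log_mul hz0.ne' (exp_pos _).ne', log_exp, log_exp] at this
    linarith
  have hw : 1 + -(β * z) / β = 1 - z := by
    field_simp
    ring
  rw [hw, sub_sub_cancel, le_div_iff₀ hβ, hlog]
  refine ⟨?_, ?_, by ring⟩
  · by_contra! h
    have h1 := one_sub_inv_le_log_of_pos hz0
    rw [hlog] at h1
    have h2 := mul_le_mul_of_nonneg_right h1 hz0.le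
    rw [sub_mul, inv_mul_cancel₀ hz0.ne'] at h2
    nlinarith [mul_pos ht hz0]
  · nlinarith [log_le_sub_one_of_pos hz0]

/-- `lim_{n→∞} n · R_n^{(β)}(t ↦ (t - x); x) = λx/(2(1-β)²)`. -/
theorem SMJ_first_central_moment_limit (W : ℝ → ℝ)
    (hW : ∀ y, -Real.exp (-1) ≤ y → W y * Real.exp (W y) = y ∧ -1 ≤ W y)
    (β lam x : ℝ) (hβ0 : 0 < β) (hβ1 : β < 1) (hlam : 0 < lam) (hx : 0 ≤ x) :
    Tendsto
      (fun n : ℕ => (n : ℝ) *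
        SMJ β n
          (-lam * x / (n * (-(1 / β) * W (-β * Real.exp (-β - lam / n)) - 1)))
          (fun t => t - x))
      atTop (nhds (lam * x / (2 * (1 - β) ^ 2))) := by
  rcases hx.eq_or_lt with rfl | hx
  · simp [SMJ]
  have hβ : 0 < 1 - β := sub_pos.2 hβ1
  let s : ℕ → ℝ := fun n => 1 + W (-β * exp (-β - lam / n)) / β
  have hs : ∀ n : ℕ, 0 < n → 0 < s n ∧ s n ≤ lam / n / (1 - β) ∧
      -β * s n - log (1 - s n) = lam / n := by
    intro n hn
    have ht : 0 < lam / n := by positivity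
    have hle : -exp (-1) ≤ -β * exp (-β - lam / n) := by
      have h1 : exp (-β - lam / n) ≤ exp (-β) := exp_le_exp.2 (by linarith)
      have h2 : β ≤ exp (β - 1) := by linarith [add_one_le_exp (β - 1)]
      have h3 : β * exp (-β - lam / n) ≤ exp (β - 1) * exp (-β) := by gcongr
      rw [← exp_add, show β - 1 + -β = -1 by ring] at h3
      linarith
    exact lambert_deficit hβ0 hβ1 ht (hW _ hle).1 (hW _ hle).2
  have hs0 : Tendsto s atTop (nhdsWithin 0 (Set.Ioi 0)) := by
    refine tendsto_nhdsWithin_iff.2 ⟨?_, ?_⟩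
    · have hlim : Tendsto (fun n : ℕ => lam / (n : ℝ) / (1 - β)) atTop (nhds 0) := by
        simpa using (tendsto_const_div_atTop_nhds_zero_nat lam).div_const (1 - β)
      refine squeeze_zero' ?_ ?_ hlim
      · filter_upwards [eventually_gt_atTop 0] with n hn using (hs n hn).1.le
      · filter_upwards [eventually_gt_atTop 0] with n hn using (hs n hn).2.1
    · filter_upwards [eventually_gt_atTop 0] with n hn using (hs n hn).1
  have h := ((tendsto_inv_sub_inv hβ1).comp hs0).const_mul (lam * x)
  rw [mul_one_div] at h
  refine h.congr' ?_
  filter_upwards [eventually_gt_atTop 0] with n hn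
  obtain ⟨hpos, -, heq⟩ := hs n hn
  have hn' : (0 : ℝ) < n := by exact_mod_cast hn
  have hz : -(1 / β) * W (-β * exp (-β - lam / n)) - 1 = -s n := by
    simp only [s]
    ring
  have ha : n * (-lam * x / (n * -s n)) = lam * x / s n := by
    field_simp
  rw [hz, SMJ_sub_eq hβ0 hβ1 (by rw [ha]; positivity), ha, Function.comp_apply, heq]
  field_simp
end
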